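/- arXiv:math/0702293 — 5 statements merged into one kernel-verified Lean document; each statement's English description precedes it below -/
import Mathlib

section
/- Let B be a Whitehead group. Then there exist cardinals κ and λ and a surjective group homomorphism φ : ℤ^κ → ℤ^λ (between the direct products of copies of ℤ) such that the dual group B* = Hom(B, ℤ) is isomorphic to the kernel of φ. -/
open CategoryTheory

/-- `Ext1 A C` is the abelian group `Ext¹_ℤ(A, C)` (as a type), computed in the
category of `ℤ`-modules, i.e. abelian groups. -/
noncomputable abbrev Ext1 (A C : Type) [AddCommGroup A] [AddCommGroup C] : Type _ :=
  ((Ext ℤ (ModuleCat.{0} ℤ) 1).obj (Opposite.op (ModuleCat.of ℤ A))).obj (ModuleCat.of ℤ C)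

/-- An abelian group `A` is a Whitehead group if `Ext¹_ℤ(A, ℤ) = 0`. -/
def IsWhitehead (A : Type) [AddCommGroup A] : Prop := Subsingleton (Ext1 A ℤ)

/-- A submodule of the free module `ι →₀ R` over a principal ideal domain is free, for any
index type `ι`. -/
theorem Submodule.free_of_finsupp_of_pid {R ι : Type*} [CommRing R] [IsDomain R]
    [IsPrincipalIdealRing R] (N : Submodule R (ι →₀ R)) : Module.Free R N := by
  classical
  obtain ⟨_, _⟩ := exists_wellFoundedLT ι
  let L (i : ι) : Ideal R := (N ⊓ Finsupp.supported R R (Set.Iic i)).map (Finsupp.lapply i)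
  have hL (i : ι) : ∃ x ∈ N, (∀ j, i < j → x j = 0) ∧ x i = IsPrincipal.generator (L i) := by
    obtain ⟨x, ⟨hxN, hx⟩, h⟩ := IsPrincipal.generator_mem (L i)
    refine ⟨x, hxN, fun j hj => ?_, h⟩
    exact Finsupp.notMem_support_iff.1 fun hjs => (hx hjs).not_gt hj
  choose x hxN hx_lt hx_gen using hL
  let v (i : {i // x i i ≠ 0}) : N := ⟨x i, hxN i⟩
  have hli : LinearIndependent R v := by
    refine (linearIndependent_iff (R := R) (v := v)).2 fun l hl => ?_
    by_contra hne
    have hs : l.support.Nonempty := Finsupp.support_nonempty_iff.2 hne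
    have hm := l.support.max'_mem hs
    set m := l.support.max' hs with hm_def
    have h0 : ((Finsupp.linearCombination R v l : N) : ι →₀ R) m = l m * x m m := by
      rw [Finsupp.linearCombination_apply, Finsupp.sum, AddSubmonoidClass.coe_finsetSum,
        Finsupp.finsetSum_apply, Finset.sum_eq_single m]
      · rfl
      · intro b hb hbm
        have hlt : b < m := lt_of_le_of_ne (l.support.le_max' b hb) hbm
        simp [v, hx_lt b m hlt]
      · exact fun h => absurd hm h
    rw [hl] at h0
    exact mul_ne_zero (Finsupp.mem_support_iff.1 hm) m.2 h0.symm
  have key (i : ι) : ∀ y : N, (∀ j, i < j → y.1 j = 0) → y ∈ span R (Set.range v) := by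
    induction i using WellFoundedLT.induction with
    | ind i ih =>
      have lower (z : N) (hz : ∀ j, i ≤ j → z.1 j = 0) : z ∈ span R (Set.range v) := by
        rcases eq_or_ne z.1 0 with h0 | h0
        · rw [show z = 0 from Subtype.ext h0]
          exact zero_mem _
        · have hs := Finsupp.support_nonempty_iff.2 h0
          have hm := z.1.support.max'_mem hs
          refine ih (z.1.support.max' hs) ?_ z fun j hj => ?_
          · by_contra hle
            exact Finsupp.mem_support_iff.1 hm (hz _ (not_lt.1 hle))
          · by_contra hzj
            exact (z.1.support.le_max' j (Finsupp.mem_support_iff.2 hzj)).not_gt hj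
      intro y hy
      have hyL : y.1 i ∈ L i := by
        refine ⟨y.1, ⟨y.2, fun j hj => ?_⟩, rfl⟩
        by_contra hji
        exact Finsupp.mem_support_iff.1 hj (hy j (not_le.1 hji))
      obtain ⟨k, hk⟩ := (IsPrincipal.mem_iff_eq_smul_generator (L i)).1 hyL
      rw [← hx_gen, smul_eq_mul] at hk
      by_cases ha : x i i = 0
      · refine lower y fun j hj => ?_
        rcases hj.eq_or_lt with rfl | hj
        · rw [hk, ha, mul_zero]
        · exact hy j hj
      · have hv : k • v ⟨i, ha⟩ ∈ span R (Set.range v) :=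
          smul_mem _ _ (subset_span ⟨_, rfl⟩)
        rw [← sub_add_cancel y (k • v ⟨i, ha⟩)]
        refine add_mem (lower _ fun j hj => ?_) hv
        rcases hj.eq_or_lt with rfl | hj
        · simp [v, hk]
        · simp [v, hy j hj, hx_lt i j hj]
  refine Module.Free.of_basis (Module.Basis.mk hli fun y _ => ?_)
  rcases eq_or_ne y.1 0 with h0 | h0
  · rw [show y = 0 from Subtype.ext h0]
    exact zero_mem _
  · have hs := Finsupp.support_nonempty_iff.2 h0
    refine key (y.1.support.max' hs) y fun j hj => ?_
    by_contra hyj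
    exact (y.1.support.le_max' j (Finsupp.mem_support_iff.2 hyj)).not_gt hj

/-- A module embedding into a free module over a principal ideal domain is free. -/
theorem Module.Free.of_injective_of_pid {R M F : Type*} [CommRing R] [IsDomain R]
    [IsPrincipalIdealRing R] [AddCommGroup M] [Module R M] [AddCommGroup F] [Module R F]
    [Module.Free R F] (f : M →ₗ[R] F) (hf : Function.Injective f) : Module.Free R M := by
  let g := (Module.Free.chooseBasis R F).repr.toLinearMap ∘ₗ f
  have hg : Function.Injective g := (Module.Free.chooseBasis R F).repr.injective.comp hf
  have := Submodule.free_of_finsupp_of_pid (LinearMap.range g)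
  exact Module.Free.of_equiv (LinearEquiv.ofInjective g hg).symm

/-- A projective module over a principal ideal domain is free. -/
theorem Module.Free.of_projective_of_pid {R M : Type*} [CommRing R] [IsDomain R]
    [IsPrincipalIdealRing R] [AddCommGroup M] [Module R M] [Module.Projective R M] :
    Module.Free R M := by
  obtain ⟨s, hs⟩ := Module.projective_def'.1 ‹Module.Projective R M›
  exact Module.Free.of_injective_of_pid s
    (Function.LeftInverse.injective (g := Finsupp.linearCombination R id) (LinearMap.congr_fun hs))

/-- If `Ext¹(X, Y)` vanishes, then every morphism `P₁ ⟶ Y` killing the image of `P₂` in a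
projective resolution `P` of `X` factors through `P₁ ⟶ P₀`. -/
theorem CategoryTheory.ProjectiveResolution.exists_d_comp_eq_of_subsingleton_ext
    {R C : Type*} [Ring R] [Category* C] [Abelian C] [Linear R C] [EnoughProjectives C]
    {X Y : C} (P : ProjectiveResolution X)
    (h : Subsingleton (((Ext R C 1).obj (Opposite.op X)).obj Y))
    (f : P.complex.X 1 ⟶ Y) (hf : P.complex.d 2 1 ≫ f = 0) :
    ∃ g : P.complex.X 0 ⟶ Y, P.complex.d 1 0 ≫ g = f := by
  have hz := (ModuleCat.isZero_of_subsingleton _).of_iso (P.isoExt (R := R) 1 Y).symm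
  rw [← HomologicalComplex.exactAt_iff_isZero_homology,
    HomologicalComplex.exactAt_iff' _ 0 1 2 (by simp) (by simp),
    ShortComplex.moduleCat_exact_iff] at hz
  exact hz f hf

/-- Let `p : P → B` be a surjection from a free module over a principal ideal domain. If every
functional on `ker p` extends to `P`, then the dual of `B` is the kernel of a surjection between
direct products of copies of the base ring. -/
theorem exists_surjective_pi_dual_equiv_ker.{u} {R B : Type*} {P : Type u} [CommRing R]
    [IsDomain R] [IsPrincipalIdealRing R] [AddCommGroup B] [Module R B] [AddCommGroup P]
    [Module R P] [Module.Free R P] (p : P →ₗ[R] B) (hp : Function.Surjective p)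
    (hext : ∀ f : LinearMap.ker p →ₗ[R] R,
      ∃ g : P →ₗ[R] R, ∀ y : LinearMap.ker p, g y = f y) :
    ∃ (κ lam : Type u) (φ : (κ → R) →ₗ[R] (lam → R)),
      Function.Surjective φ ∧ Nonempty ((B →ₗ[R] R) ≃ₗ[R] LinearMap.ker φ) := by
  have : Module.Free R (LinearMap.ker p) :=
    Module.Free.of_injective_of_pid _ (LinearMap.ker p).injective_subtype
  let e := Module.Free.constr R P R (S := R)
  let e' := Module.Free.constr R (LinearMap.ker p) R (S := R)
  let φ := e'.symm.toLinearMap ∘ₗ LinearMap.lcomp R R (LinearMap.ker p).subtype ∘ₗ e.toLinearMap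
  let ψ := e.symm.toLinearMap ∘ₗ LinearMap.lcomp R R p
  have hψ : Function.Injective ψ :=
    e.symm.injective.comp (LinearMap.lcomp_injective_of_surjective p hp)
  have hr : LinearMap.range ψ = LinearMap.ker φ := by
    ext c
    have hc : c ∈ LinearMap.ker φ ↔ e c ∘ₗ (LinearMap.ker p).subtype = 0 :=
      e'.symm.map_eq_zero_iff
    rw [hc]
    constructor
    · rintro ⟨b, rfl⟩
      have hb : e (ψ b) = b ∘ₗ p := e.apply_symm_apply _
      rw [hb, LinearMap.comp_assoc, LinearMap.comp_ker_subtype, LinearMap.comp_zero]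
    · intro h
      have hle : LinearMap.ker p ≤ LinearMap.ker (e c) := fun y hy =>
        LinearMap.congr_fun h ⟨y, hy⟩
      refine ⟨(LinearMap.ker p).liftQ (e c) hle ∘ₗ
        (p.quotKerEquivOfSurjective hp).symm.toLinearMap, e.symm_apply_eq.2 ?_⟩
      ext y
      have hy : (p.quotKerEquivOfSurjective hp).symm (p y) = Submodule.Quotient.mk y := by
        rw [LinearEquiv.symm_apply_eq]
        rfl
      simp [hy]
  refine ⟨_, _, φ, fun c => ?_,
    ⟨(LinearEquiv.ofInjective ψ hψ).trans (LinearEquiv.ofEq _ _ hr)⟩⟩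
  obtain ⟨g, hg⟩ := hext (e' c)
  refine ⟨e.symm g, e'.symm_apply_eq.2 ?_⟩
  rw [LinearMap.comp_apply, LinearEquiv.coe_coe, e.apply_symm_apply]
  exact LinearMap.ext hg

/-- The dual `B* = Hom(B,ℤ)` of a Whitehead group `B` is the kernel of a surjective
homomorphism `ℤ^κ → ℤ^λ` between direct products of copies of `ℤ`. -/
theorem dual_of_whitehead_is_kernel (B : Type) [AddCommGroup B] (hB : IsWhitehead B) :
    ∃ (κ lam : Type) (φ : (κ → ℤ) →+ (lam → ℤ)),
      Function.Surjective φ ∧ Nonempty ((B →+ ℤ) ≃+ φ.ker) := by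
  let P := projectiveResolution (ModuleCat.of ℤ B)
  have : Module.Projective ℤ (P.complex.X 0) :=
    (IsProjective.iff_projective (P.complex.X 0)).2 (P.projective 0)
  have : Module.Free ℤ (P.complex.X 0) := Module.Free.of_projective_of_pid
  let p : P.complex.X 0 →ₗ[ℤ] B := (P.π.f 0).hom
  have hp : Function.Surjective p :=
    (ModuleCat.epi_iff_surjective (P.π.f 0)).1 inferInstance
  have hexact := (ShortComplex.moduleCat_exact_iff _).1 P.exact₀
  obtain ⟨κ, lam, φ, hφ, ⟨E⟩⟩ := exists_surjective_pi_dual_equiv_ker p hp fun f => by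
    let d := (P.complex.d 1 0).hom.codRestrict (LinearMap.ker p) fun x =>
      ConcreteCategory.congr_hom P.complex_d_comp_π_f_zero x
    have hd : P.complex.d 2 1 ≫ ModuleCat.ofHom (f ∘ₗ d) = 0 := by
      ext x
      have h0 : d ((P.complex.d 2 1).hom x) = 0 :=
        Subtype.ext (ConcreteCategory.congr_hom (P.complex.d_comp_d 2 1 0) x)
      change f (d ((P.complex.d 2 1).hom x)) = 0
      rw [h0, map_zero]
    obtain ⟨g, hg⟩ := P.exists_d_comp_eq_of_subsingleton_ext hB _ hd
    refine ⟨g.hom, fun ⟨y, hy⟩ => ?_⟩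
    obtain ⟨x, rfl⟩ := hexact y hy
    exact ConcreteCategory.congr_hom hg x
  exact ⟨κ, lam, φ.toAddMonoidHom, hφ,
    ⟨(addMonoidHomLequivInt (A := B) (B := ℤ) ℤ).toAddEquiv.trans E.toAddEquiv⟩⟩
end

section
/- If A and B are Whitehead groups, then there is an isomorphism of abelian groups Ext^1_ℤ(A, B*) ≅ Ext^1_ℤ(B, A*), where A* = Hom(A, ℤ) and B* = Hom(B, ℤ). -/
open CategoryTheory

/-- The bilinear forms on `F × G` that vanish on `ker p × ker q`. -/
def formsVanishingOnKer {F G A B : Type} [AddCommGroup F] [AddCommGroup G] [AddCommGroup A]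
    [AddCommGroup B] (p : F →ₗ[ℤ] A) (q : G →ₗ[ℤ] B) : AddSubgroup (F →ₗ[ℤ] G →ₗ[ℤ] ℤ) where
  carrier := {b | ∀ x ∈ LinearMap.ker p, ∀ y ∈ LinearMap.ker q, b x y = 0}
  zero_mem' := by simp
  add_mem' {b c} hb hc x hx y hy := by simp [hb x hx y hy, hc x hx y hy]
  neg_mem' {b} hb x hx y hy := by simp [hb x hx y hy]

/-- Flipping the variables of forms vanishing on `ker p × ker q`. -/
def formsVanishingOnKerFlip {F G A B : Type} [AddCommGroup F] [AddCommGroup G] [AddCommGroup A]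
    [AddCommGroup B] (p : F →ₗ[ℤ] A) (q : G →ₗ[ℤ] B) :
    formsVanishingOnKer p q →+ formsVanishingOnKer q p where
  toFun b := ⟨b.1.flip, fun y hy x hx => b.2 x hx y hy⟩
  map_zero' := rfl
  map_add' _ _ := rfl

/-- A form vanishing on `ker q` in its second variable descends along the surjection `q`. -/
lemma exists_descend_of_surjective {N G B : Type} [AddCommGroup N] [AddCommGroup G]
    [AddCommGroup B] {q : G →ₗ[ℤ] B} (hq : Function.Surjective q) (b : N →ₗ[ℤ] G →ₗ[ℤ] ℤ)
    (hb : ∀ n, ∀ y ∈ LinearMap.ker q, b n y = 0) :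
    ∃ c : N →ₗ[ℤ] (B →+ ℤ), ∀ n y, c n (q y) = b n y := by
  have key : ∀ n y y', q y = q y' → b n y = b n y' := fun n y y' h => by
    rw [← sub_eq_zero, ← map_sub]
    exact hb n _ (by simp [h])
  let s := Function.surjInv hq
  have hs : ∀ z, q (s z) = z := Function.surjInv_eq hq
  refine ⟨AddMonoidHom.toIntLinearMap (AddMonoidHom.mk' (fun n => AddMonoidHom.mk'
    (fun z => b n (s z)) fun z z' => ?_) fun n n' => ?_), fun n y => ?_⟩
  · rw [← map_add]
    exact key n _ _ (by simp [hs])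
  · ext z
    simp
  · exact key n _ _ (hs _)

/-- If `G` is projective and functionals extend from `ker p` to `F`, then the cokernel of
`Hom(F, B*) → Hom(ker p, B*)` is a quotient of the forms vanishing on `ker p × ker q` by the sums
of a form vanishing on `ker p × G` and a form vanishing on `F × ker q`. -/
lemma exists_hom_formsVanishingOnKer {F G A B E : Type} [AddCommGroup F] [AddCommGroup G]
    [AddCommGroup A] [AddCommGroup B] [AddCommGroup E] [Module.Projective ℤ G]
    (p : F →ₗ[ℤ] A) {q : G →ₗ[ℤ] B} (hq : Function.Surjective q)
    (hp : ∀ f : LinearMap.ker p →ₗ[ℤ] ℤ, ∃ g : F →ₗ[ℤ] ℤ, g ∘ₗ (LinearMap.ker p).subtype = f)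
    (φ : (LinearMap.ker p →ₗ[ℤ] (B →+ ℤ)) →+ E) (hφ : Function.Surjective φ)
    (hφ0 : ∀ x, φ x = 0 ↔ ∃ y : F →ₗ[ℤ] (B →+ ℤ), y ∘ₗ (LinearMap.ker p).subtype = x) :
    ∃ ψ : formsVanishingOnKer p q →+ E, Function.Surjective ψ ∧
      ∀ b, ψ b = 0 ↔ ∃ b₁ b₂ : F →ₗ[ℤ] G →ₗ[ℤ] ℤ, b.1 = b₁ + b₂ ∧
        (∀ x ∈ LinearMap.ker p, ∀ y, b₁ x y = 0) ∧ (∀ x, ∀ y ∈ LinearMap.ker q, b₂ x y = 0) := by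
  have hd : ∀ b : formsVanishingOnKer p q, ∃ c : LinearMap.ker p →ₗ[ℤ] (B →+ ℤ),
      ∀ n y, c n (q y) = b.1 n y := fun b =>
    exists_descend_of_surjective hq (b.1 ∘ₗ (LinearMap.ker p).subtype)
      fun n y hy => b.2 n n.2 y hy
  choose d hd using hd
  have ext_q : ∀ {N : Type} [AddCommGroup N] (c c' : N →ₗ[ℤ] (B →+ ℤ)),
      (∀ n y, c n (q y) = c' n (q y)) → c = c' := fun c c' h => by
    ext n z
    obtain ⟨y, rfl⟩ := hq z
    exact h n y
  let D : formsVanishingOnKer p q →+ (LinearMap.ker p →ₗ[ℤ] (B →+ ℤ)) :=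
    AddMonoidHom.mk' d fun b b' => ext_q _ _ fun n y => by simp [hd]
  have hD : ∀ b n y, D b n (q y) = b.1 n y := hd
  refine ⟨φ.comp D, hφ.comp fun x => ?_, fun b => ?_⟩
  · let b₀ : LinearMap.ker p →ₗ[ℤ] G →ₗ[ℤ] ℤ := AddMonoidHom.toIntLinearMap
      (AddMonoidHom.mk' (fun n => ((x n).comp q.toAddMonoidHom).toIntLinearMap)
        fun n n' => by ext y; simp)
    have hres : Function.Surjective (LinearMap.lcomp ℤ ℤ (LinearMap.ker p).subtype) :=
      fun f => hp f
    obtain ⟨h, hh⟩ := Module.projective_lifting_property _ b₀.flip hres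
    have hb : ∀ (n : LinearMap.ker p) y, h.flip n y = x n (q y) := fun n y =>
      LinearMap.congr_fun (LinearMap.congr_fun hh y) n
    refine ⟨⟨h.flip, fun n hn y hy => ?_⟩, ext_q _ _ fun n y => ?_⟩
    · rw [hb ⟨n, hn⟩ y, LinearMap.mem_ker.1 hy, map_zero]
    · rw [hD]
      exact hb n y
  · rw [AddMonoidHom.comp_apply, hφ0]
    constructor
    · rintro ⟨y, hy⟩
      let b₂ : F →ₗ[ℤ] G →ₗ[ℤ] ℤ := AddMonoidHom.toIntLinearMap
        (AddMonoidHom.mk' (fun n => ((y n).comp q.toAddMonoidHom).toIntLinearMap)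
          fun n n' => by ext y; simp)
      have hb₂ : ∀ n g, b₂ n g = y n (q g) := fun n g => rfl
      refine ⟨b.1 - b₂, b₂, (sub_add_cancel _ _).symm, fun n hn g => ?_, fun n g hg => ?_⟩
      · have := hD b ⟨n, hn⟩ g
        rw [← hy] at this
        simp only [LinearMap.sub_apply, hb₂, ← this]
        exact sub_self _
      · rw [hb₂, LinearMap.mem_ker.1 hg, map_zero]
    · rintro ⟨b₁, b₂, hb, h₁, h₂⟩
      obtain ⟨y, hy⟩ := exists_descend_of_surjective hq b₂ h₂
      refine ⟨y, ext_q _ _ fun n g => ?_⟩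
      rw [hD, hb]
      simp [hy, h₁ n n.2 g]

universe u

/-- The homology of a short complex of modules is the quotient of the kernel by the range. -/
lemma ShortComplex.exists_ker_to_homology {R : Type u} [Ring R]
    (S : ShortComplex (ModuleCat.{u} R)) :
    ∃ ρ : LinearMap.ker S.g.hom →ₗ[R] S.homology, Function.Surjective ρ ∧
      ∀ x, ρ x = 0 ↔ ∃ y : S.X₁, S.f y = x.1 := by
  let e : S.homology ≃ₗ[R] (LinearMap.ker S.g.hom ⧸ LinearMap.range S.moduleCatToCycles) :=
    S.moduleCatHomologyIso.toLinearEquiv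
  refine ⟨e.symm.toLinearMap ∘ₗ Submodule.mkQ _,
    e.symm.surjective.comp (Submodule.mkQ_surjective _), fun x => ?_⟩
  change e.symm (Submodule.mkQ _ x) = 0 ↔ _
  rw [LinearEquiv.map_eq_zero_iff, Submodule.mkQ_apply, Submodule.Quotient.mk_eq_zero]
  exact exists_congr fun y => Subtype.ext_iff

/-- `Ext¹(A, C)` is the cokernel of `Hom(F, C) → Hom(ker p, C)` for some surjection `p : F → A`
from a projective `F`. -/
lemma exists_projective_presentation_ext {R A : Type u} [CommRing R] [AddCommGroup A]
    [Module R A] :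
    ∃ (F : Type u) (_ : AddCommGroup F) (_ : Module R F) (_ : Module.Projective R F)
      (p : F →ₗ[R] A), Function.Surjective p ∧
        ∀ (C : Type u) [AddCommGroup C] [Module R C],
          ∃ φ : (LinearMap.ker p →ₗ[R] C) →+ (((Ext R (ModuleCat.{u} R) 1).obj
              (Opposite.op (ModuleCat.of R A))).obj (ModuleCat.of R C)),
            Function.Surjective φ ∧
              ∀ x, φ x = 0 ↔ ∃ y : F →ₗ[R] C, y ∘ₗ (LinearMap.ker p).subtype = x := by
  let P : ProjectiveResolution (ModuleCat.of R A) := ProjectiveResolution.of _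
  let i : ((ChainComplex.single₀ (ModuleCat.{u} R)).obj (ModuleCat.of R A)).X 0 ≃ₗ[R] A :=
    (HomologicalComplex.singleObjXSelf (ComplexShape.down ℕ) 0 _).toLinearEquiv
  let p : P.complex.X 0 →ₗ[R] A := i.toLinearMap ∘ₗ (P.π.f 0).hom
  have hp : Function.Surjective p :=
    i.surjective.comp ((ModuleCat.epi_iff_surjective (P.π.f 0)).1 inferInstance)
  have hd : LinearMap.range (P.complex.d 1 0).hom = LinearMap.ker p :=
    P.exact₀.moduleCat_range_eq_ker.trans (LinearEquiv.ker_comp i _).symm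
  let d : P.complex.X 1 →ₗ[R] LinearMap.ker p := (P.complex.d 1 0).hom.codRestrict _
    fun x => hd ▸ LinearMap.mem_range_self _ x
  have hds : Function.Surjective d := by
    rintro ⟨x, hx⟩
    rw [← hd] at hx
    obtain ⟨y, rfl⟩ := hx
    exact ⟨y, rfl⟩
  have hd2 : LinearMap.range (P.complex.d 2 1).hom = LinearMap.ker d :=
    (P.exact_succ 0).moduleCat_range_eq_ker.trans (LinearMap.ker_codRestrict _ _ _).symm
  have hproj : Module.Projective R (P.complex.X 0) :=
    (IsProjective.iff_projective _).2 (P.projective 0)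
  refine ⟨P.complex.X 0, inferInstance, inferInstance, hproj, p, hp, fun C _ _ => ?_⟩
  let K := P.complex.linearYonedaObj R (ModuleCat.of R C)
  obtain ⟨ρ, hρ, hρ0⟩ := ShortComplex.exists_ker_to_homology (K.sc' 0 1 2)
  let e : (K.sc' 0 1 2).homology ≃ₗ[R] (((Ext R (ModuleCat.{u} R) 1).obj
              (Opposite.op (ModuleCat.of R A))).obj (ModuleCat.of R C)) :=
    ((P.isoExt (R := R) 1 (ModuleCat.of R C)) ≪≫
      K.homologyIsoSc' 0 1 2 (by simp) (by simp)).toLinearEquiv.symm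
  have hg : ∀ f : P.complex.X 1 ⟶ ModuleCat.of R C,
      (K.sc' 0 1 2).g f = (P.complex.d 2 1 ≫ f : P.complex.X 2 ⟶ _) := fun f => rfl
  have hf : ∀ f : P.complex.X 0 ⟶ ModuleCat.of R C,
      (K.sc' 0 1 2).f f = (P.complex.d 1 0 ≫ f : P.complex.X 1 ⟶ _) := fun f => rfl
  let c : (LinearMap.ker p →ₗ[R] C) →+ LinearMap.ker (K.sc' 0 1 2).g.hom :=
    AddMonoidHom.mk' (fun f => ⟨ModuleCat.ofHom (f ∘ₗ d), by
      refine (hg _).trans (ModuleCat.hom_ext (LinearMap.ext fun x => ?_))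
      have : P.complex.d 2 1 x ∈ LinearMap.ker d := hd2 ▸ LinearMap.mem_range_self _ x
      exact (congrArg f this).trans (map_zero f)⟩) fun f f' => rfl
  refine ⟨(e.toLinearMap ∘ₗ ρ).toAddMonoidHom.comp c,
    (e.surjective.comp hρ).comp ?_, fun x => ?_⟩
  · rintro ⟨f, hf'⟩
    let f' : P.complex.X 1 →ₗ[R] C := (show P.complex.X 1 ⟶ ModuleCat.of R C from f).hom
    have hf'' : LinearMap.ker d ≤ LinearMap.ker f' := by
      rw [← hd2]
      rintro _ ⟨x, rfl⟩
      exact congr($((hg f).symm.trans hf').hom x)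
    refine ⟨(LinearMap.ker d).liftQ f' hf'' ∘ₗ
      (d.quotKerEquivOfSurjective hds).symm.toLinearMap, ?_⟩
    refine Subtype.ext (ModuleCat.hom_ext (LinearMap.ext fun x => ?_))
    change (LinearMap.ker d).liftQ f' hf'' ((d.quotKerEquivOfSurjective hds).symm (d x)) = f' x
    rw [LinearMap.quotKerEquivOfSurjective_symm_apply]
    simp
  · change e (ρ (c x)) = 0 ↔ _
    rw [LinearEquiv.map_eq_zero_iff, hρ0]
    constructor
    · rintro ⟨y, hy⟩
      refine ⟨(show P.complex.X 0 ⟶ ModuleCat.of R C from y).hom, LinearMap.ext fun z => ?_⟩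
      obtain ⟨z, rfl⟩ := hds z
      exact congr($((hf y).symm.trans hy).hom z)
    · rintro ⟨y, rfl⟩
      exact ⟨ModuleCat.ofHom y, rfl⟩

/-- `Ext1 A C` is the cokernel of `Hom(F, C) → Hom(ker p, C)` for some surjection `p : F → A`
from a projective `F`. -/
lemma exists_presentation_ext1 (A : Type) [AddCommGroup A] :
    ∃ (F : Type) (_ : AddCommGroup F) (_ : Module.Projective ℤ F) (p : F →ₗ[ℤ] A),
      Function.Surjective p ∧ ∀ (C : Type) [AddCommGroup C],
        ∃ φ : (LinearMap.ker p →ₗ[ℤ] C) →+ Ext1 A C, Function.Surjective φ ∧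
          ∀ x, φ x = 0 ↔ ∃ y : F →ₗ[ℤ] C, y ∘ₗ (LinearMap.ker p).subtype = x := by
  obtain ⟨F, _, m, hF, p, hp, h⟩ := exists_projective_presentation_ext (R := ℤ) (A := A)
  obtain rfl : m = AddCommGroup.toIntModule F := Subsingleton.elim _ _
  exact ⟨F, _, hF, p, hp, fun C _ => h C⟩

/-- For Whitehead groups `A` and `B`, `Ext¹(A, B*) ≅ Ext¹(B, A*)` as abelian groups. -/
theorem ext_dual_symm (A B : Type) [AddCommGroup A] [AddCommGroup B]
    (hA : IsWhitehead A) (hB : IsWhitehead B) :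
    Nonempty (Ext1 A (B →+ ℤ) ≃+ Ext1 B (A →+ ℤ)) := by
  have hA' : Subsingleton (Ext1 A ℤ) := hA
  have hB' : Subsingleton (Ext1 B ℤ) := hB
  obtain ⟨F, _, _, p, hp, hF⟩ := exists_presentation_ext1 A
  obtain ⟨G, _, _, q, hq, hG⟩ := exists_presentation_ext1 B
  obtain ⟨φ, hφ, hφ0⟩ := hF (B →+ ℤ)
  obtain ⟨χ, hχ, hχ0⟩ := hG (A →+ ℤ)
  obtain ⟨φ', -, hφ'⟩ := hF ℤ
  obtain ⟨χ', -, hχ'⟩ := hG ℤ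
  obtain ⟨ψ, hψ, hψ0⟩ := exists_hom_formsVanishingOnKer p hq
    (fun f => (hφ' f).1 (Subsingleton.elim _ _)) φ hφ hφ0
  obtain ⟨θ, hθ, hθ0⟩ := exists_hom_formsVanishingOnKer q hp
    (fun f => (hχ' f).1 (Subsingleton.elim _ _)) χ hχ hχ0
  have hθ' : Function.Surjective (θ.comp (formsVanishingOnKerFlip p q)) :=
    hθ.comp fun b => ⟨formsVanishingOnKerFlip q p b, rfl⟩
  have hker : ψ.ker = (θ.comp (formsVanishingOnKerFlip p q)).ker := by
    ext b
    rw [AddMonoidHom.mem_ker, AddMonoidHom.mem_ker, AddMonoidHom.comp_apply, hψ0, hθ0]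
    constructor
    · rintro ⟨b₁, b₂, hb, h₁, h₂⟩
      refine ⟨b₂.flip, b₁.flip, ?_, fun y hy x => h₂ x y hy, fun y x hx => h₁ x hx y⟩
      change b.1.flip = _
      rw [hb, add_comm]
      rfl
    · rintro ⟨b₁, b₂, hb, h₁, h₂⟩
      refine ⟨b₂.flip, b₁.flip, ?_, fun x hx y => h₂ y x hx, fun x y hy => h₁ y hy x⟩
      change b.1.flip = _ at hb
      rw [← LinearMap.flip_flip b.1, hb, add_comm]
      rfl
  exact ⟨(QuotientAddGroup.quotientKerEquivOfSurjective ψ hψ).symm.trans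
    ((QuotientAddGroup.quotientAddEquivOfEq hker).trans
      (QuotientAddGroup.quotientKerEquivOfSurjective _ hθ'))⟩
end

section
/- If A and B are Whitehead groups, then there is an isomorphism of abelian groups Ext^1_ℤ(A, B*) ≅ Ext^1_ℤ(A ⊗ B, ℤ), where B* = Hom(B, ℤ) and A ⊗ B is the tensor product over ℤ. -/
open CategoryTheory

section ExtensionProblems

universe u

variable {R : Type u} [CommRing R]
  {A B C E F : Type u} [AddCommGroup A] [Module R A] [AddCommGroup B] [Module R B]
  [AddCommGroup C] [Module R C] [AddCommGroup E] [Module R E] [AddCommGroup F] [Module R F]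

/-- The cokernel of the restriction map `Hom(F, C) → Hom(K, C)`, for a submodule `K` of `F`. -/
abbrev RestrictionCoker (K : Submodule R F) (C : Type u) [AddCommGroup C] [Module R C] : Type u :=
  (K →ₗ[R] C) ⧸ LinearMap.range (LinearMap.lcomp R C K.subtype)

variable (R) in
/-- Every homomorphism out of `B` lifts along every epimorphism with kernel `C`;
this is a form of `Ext¹(B, C) = 0`. -/
def LiftsAlongExtensionsBy (B C : Type u) [AddCommGroup B] [Module R B]
    [AddCommGroup C] [Module R C] : Prop :=
  ∀ (M N : Type u) [AddCommGroup M] [Module R M] [AddCommGroup N] [Module R N]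
    (j : C →ₗ[R] M) (r : M →ₗ[R] N), Function.Injective j → Function.Exact j r →
    Function.Surjective r → ∀ f : B →ₗ[R] N, ∃ g : B →ₗ[R] M, r ∘ₗ g = f

theorem LinearMap.exists_comp_eq_of_ker_le {p : E →ₗ[R] F} (hp : Function.Surjective p)
    {f : E →ₗ[R] C} (hf : LinearMap.ker p ≤ LinearMap.ker f) : ∃ g : F →ₗ[R] C, g ∘ₗ p = f := by
  refine ⟨(LinearMap.ker p).liftQ f hf ∘ₗ (p.quotKerEquivOfSurjective hp).symm.toLinearMap, ?_⟩
  ext x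
  have : (p.quotKerEquivOfSurjective hp).symm (p x) = (LinearMap.ker p).mkQ x := by
    rw [LinearEquiv.symm_apply_eq]; rfl
  simp [this]

theorem liftsAlongExtensionsBy_of_projective [Module.Projective R B] :
    LiftsAlongExtensionsBy R B C :=
  fun _ _ _ _ _ _ _ r _ _ hr f => Module.projective_lifting_property r f hr

theorem LiftsAlongExtensionsBy.tensorProduct [Module.Projective R F]
    (hB : LiftsAlongExtensionsBy R B C) :
    LiftsAlongExtensionsBy R (TensorProduct R F B) C := by
  intro M N _ _ _ _ j r hj hjr hr f
  obtain ⟨g, hg⟩ := Module.projective_lifting_property (LinearMap.compRight R (M := B) r)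
    (TensorProduct.curry f) (hB M N j r hj hjr hr)
  refine ⟨TensorProduct.lift g, TensorProduct.ext' fun x b => ?_⟩
  simpa using LinearMap.congr_fun (LinearMap.congr_fun hg x) b

theorem liftsAlongExtensionsBy_of_forall_extends [Module.Projective R F] {p : F →ₗ[R] B}
    (hp : Function.Surjective p)
    (h : ∀ f : LinearMap.ker p →ₗ[R] C, ∃ g : F →ₗ[R] C, g ∘ₗ (LinearMap.ker p).subtype = f) :
    LiftsAlongExtensionsBy R B C := by
  intro M N _ _ _ _ j r hj hjr hr f
  obtain ⟨g, hg⟩ := Module.projective_lifting_property r (f ∘ₗ p) hr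
  have hmem : ∀ x : LinearMap.ker p, g x ∈ LinearMap.range j := fun x =>
    (hjr (g x)).1 (by simpa using LinearMap.congr_fun hg x)
  let e := LinearEquiv.ofInjective j hj
  obtain ⟨k, hk⟩ := h (e.symm.toLinearMap ∘ₗ
    (g ∘ₗ (LinearMap.ker p).subtype).codRestrict (LinearMap.range j) hmem)
  have hk' : ∀ x : LinearMap.ker p, j (k x) = g x := fun x => by
    have h1 : k x = e.symm ⟨g x, hmem x⟩ := LinearMap.congr_fun hk x
    have h2 : (e (k x) : M) = g x := by rw [h1, LinearEquiv.apply_symm_apply]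
    exact h2
  obtain ⟨l, hl⟩ := LinearMap.exists_comp_eq_of_ker_le (f := g - j ∘ₗ k) hp fun x hx => by
    simp [hk' ⟨x, hx⟩]
  refine ⟨l, LinearMap.ext fun b => ?_⟩
  obtain ⟨x, rfl⟩ := hp b
  have h1 : l (p x) = g x - j (k x) := LinearMap.congr_fun hl x
  have h2 : r (g x) = f (p x) := LinearMap.congr_fun hg x
  simp [h1, h2, hjr.apply_apply_eq_zero]

theorem LiftsAlongExtensionsBy.exists_extension (hF : LiftsAlongExtensionsBy R F C)
    {p : E →ₗ[R] F} (hp : Function.Surjective p) (f : LinearMap.ker p →ₗ[R] C) :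
    ∃ g : E →ₗ[R] C, g ∘ₗ (LinearMap.ker p).subtype = f := by
  -- push the extension `E` of `F` out along `f`; a section of the result gives the extension of `f`
  let S : Submodule R (C × E) := LinearMap.range (LinearMap.prod f (-(LinearMap.ker p).subtype))
  have hS : S ≤ LinearMap.ker (p ∘ₗ LinearMap.snd R C E) := by
    rintro _ ⟨x, rfl⟩
    simp
  let j : C →ₗ[R] (C × E) ⧸ S := S.mkQ ∘ₗ LinearMap.inl R C E
  let r : (C × E) ⧸ S →ₗ[R] F := S.liftQ (p ∘ₗ LinearMap.snd R C E) hS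
  have hj : Function.Injective j := by
    rw [← LinearMap.ker_eq_bot, LinearMap.ker_eq_bot']
    intro c hc
    obtain ⟨x, hx⟩ := (Submodule.Quotient.mk_eq_zero S).1 hc
    have hx1 : f x = c := congrArg Prod.fst hx
    have hx2 : -(x : E) = 0 := congrArg Prod.snd hx
    have : x = 0 := Subtype.ext (neg_eq_zero.1 hx2)
    rw [← hx1, this, map_zero]
  have hr : Function.Surjective r := fun y => by
    obtain ⟨x, rfl⟩ := hp y
    exact ⟨S.mkQ (0, x), rfl⟩
  have hjr : Function.Exact j r := fun m => by
    constructor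
    · intro hm
      obtain ⟨⟨c, x⟩, rfl⟩ := S.mkQ_surjective m
      have hx : p x = 0 := hm
      refine ⟨c + f ⟨x, hx⟩, (Submodule.Quotient.eq S).2 ⟨⟨x, hx⟩, ?_⟩⟩
      ext <;> simp
    · rintro ⟨c, rfl⟩
      change p 0 = 0
      simp
  obtain ⟨s, hs⟩ := hF _ _ j r hj hjr hr LinearMap.id
  have hmem : ∀ m, (LinearMap.id - s ∘ₗ r : _ →ₗ[R] (C × E) ⧸ S) m ∈ LinearMap.range j := fun m =>
    (hjr _).1 (by simpa [sub_eq_zero] using (LinearMap.congr_fun hs (r m)).symm)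
  let e := LinearEquiv.ofInjective j hj
  refine ⟨e.symm.toLinearMap ∘ₗ (LinearMap.id - s ∘ₗ r).codRestrict (LinearMap.range j) hmem ∘ₗ
    S.mkQ ∘ₗ LinearMap.inr R C E, LinearMap.ext fun x => ?_⟩
  refine (LinearEquiv.symm_apply_eq e).2 (Subtype.ext ?_)
  have hx : r (S.mkQ (0, (x : E))) = 0 := x.2
  have hval : S.mkQ (0, (x : E)) = j (f x) :=
    ((Submodule.Quotient.eq S).2 ⟨x, by ext <;> simp⟩ : S.mkQ (f x, 0) = S.mkQ (0, (x : E))).symm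
  change S.mkQ (0, (x : E)) - s (r (S.mkQ (0, (x : E)))) = j (f x)
  rw [hx, map_zero, sub_zero, hval]

theorem nonempty_restrictionCoker_equiv_comap {p : E →ₗ[R] F} (hp : Function.Surjective p)
    (hF : LiftsAlongExtensionsBy R F C) (K : Submodule R F) :
    Nonempty (RestrictionCoker K C ≃ₗ[R] RestrictionCoker (K.comap p) C) := by
  let q : K.comap p →ₗ[R] K := p.restrict fun _ hx => hx
  have hq : Function.Surjective q := fun ⟨y, hy⟩ => by
    obtain ⟨x, rfl⟩ := hp y
    exact ⟨⟨x, hy⟩, rfl⟩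
  let φ : (K →ₗ[R] C) →ₗ[R] RestrictionCoker (K.comap p) C :=
    Submodule.mkQ _ ∘ₗ LinearMap.lcomp R C q
  have hker : LinearMap.ker φ = LinearMap.range (LinearMap.lcomp R C K.subtype) := by
    ext h
    rw [LinearMap.mem_ker]
    refine (Submodule.Quotient.mk_eq_zero _).trans ⟨?_, ?_⟩
    · rintro ⟨g, hg⟩
      have hg' : ∀ x (hx : p x ∈ K), g x = h ⟨p x, hx⟩ := fun x hx => LinearMap.congr_fun hg ⟨x, hx⟩
      obtain ⟨g', rfl⟩ := LinearMap.exists_comp_eq_of_ker_le (f := g) hp fun x hx => by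
        rw [LinearMap.mem_ker] at hx
        have h0 : (⟨p x, hx ▸ K.zero_mem⟩ : K) = 0 := Subtype.ext hx
        rw [LinearMap.mem_ker, hg' x (hx ▸ K.zero_mem), h0, map_zero]
      refine ⟨g', LinearMap.ext fun y => ?_⟩
      obtain ⟨x, hx⟩ := hp y
      have := hg' x (hx ▸ y.2)
      simpa [hx] using this
    · rintro ⟨g, rfl⟩
      exact ⟨g ∘ₗ p, rfl⟩
  have hsurj : Function.Surjective φ := fun z => by
    obtain ⟨f, rfl⟩ := Submodule.mkQ_surjective _ z
    have hle : LinearMap.ker p ≤ K.comap p := fun x hx => by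
      rw [Submodule.mem_comap, LinearMap.mem_ker.1 hx]; exact K.zero_mem
    obtain ⟨g, hg⟩ := hF.exists_extension hp (f ∘ₗ Submodule.inclusion hle)
    obtain ⟨h, hh⟩ := LinearMap.exists_comp_eq_of_ker_le
      (f := f - g ∘ₗ (K.comap p).subtype) hq fun x hx => by
        have hx' : (x : E) ∈ LinearMap.ker p := congrArg Subtype.val hx
        have hgx : g x = f x := LinearMap.congr_fun hg ⟨x, hx'⟩
        simp [hgx]
    refine ⟨h, (Submodule.Quotient.eq _).2 ⟨-g, ?_⟩⟩
    change _ = h ∘ₗ q - f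
    rw [hh]
    ext x
    simp
  exact ⟨(Submodule.quotEquivOfEq _ _ hker.symm).trans (φ.quotKerEquivOfSurjective hsurj)⟩

/-- `RestrictionCoker (ker π) C` computes `Ext¹(A, C)` for any epimorphism `π : F → A` with
`Ext¹(F, C) = 0`, so it does not depend on `π`. -/
theorem nonempty_restrictionCoker_ker_equiv {F' : Type u} [AddCommGroup F'] [Module R F']
    {π : F →ₗ[R] A} {π' : F' →ₗ[R] A} (hπ : Function.Surjective π) (hπ' : Function.Surjective π')
    (hF : LiftsAlongExtensionsBy R F C) (hF' : LiftsAlongExtensionsBy R F' C) :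
    Nonempty (RestrictionCoker (LinearMap.ker π) C ≃ₗ[R]
      RestrictionCoker (LinearMap.ker π') C) := by
  let P : Submodule R (F × F') :=
    LinearMap.eqLocus (π ∘ₗ LinearMap.fst R F F') (π' ∘ₗ LinearMap.snd R F F')
  let p : P →ₗ[R] F := LinearMap.fst R F F' ∘ₗ P.subtype
  let p' : P →ₗ[R] F' := LinearMap.snd R F F' ∘ₗ P.subtype
  have hp : Function.Surjective p := fun x => by
    obtain ⟨y, hy⟩ := hπ' (π x)
    exact ⟨⟨(x, y), hy.symm⟩, rfl⟩
  have hp' : Function.Surjective p' := fun y => by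
    obtain ⟨x, hx⟩ := hπ (π' y)
    exact ⟨⟨(x, y), hx⟩, rfl⟩
  have hcomap : (LinearMap.ker π).comap p = (LinearMap.ker π').comap p' := by
    ext z
    have hz : π (p z) = π' (p' z) := z.2
    simp [hz]
  obtain ⟨e⟩ := nonempty_restrictionCoker_equiv_comap hp hF (LinearMap.ker π)
  obtain ⟨e'⟩ := nonempty_restrictionCoker_equiv_comap hp' hF' (LinearMap.ker π')
  rw [← hcomap] at e'
  exact ⟨e.trans e'.symm⟩

theorem nonempty_restrictionCoker_dual_equiv [Module.Flat R B] {π : F →ₗ[R] A}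
    (hπ : Function.Surjective π) :
    Nonempty (RestrictionCoker (LinearMap.ker π) (B →ₗ[R] C) ≃ₗ[R]
      RestrictionCoker (LinearMap.ker (π.rTensor B)) C) := by
  let i := (LinearMap.ker π).subtype
  have hinj : Function.Injective (i.rTensor B) :=
    Module.Flat.rTensor_preserves_injective_linearMap i (Submodule.subtype_injective _)
  have hexact : LinearMap.range (i.rTensor B) = LinearMap.ker (π.rTensor B) :=
    (LinearMap.exact_iff.1 (rTensor_exact B (LinearMap.exact_subtype_ker_map π) hπ)).symm
  let e : TensorProduct R (LinearMap.ker π) B ≃ₗ[R] LinearMap.ker (π.rTensor B) :=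
    (LinearEquiv.ofInjective _ hinj).trans (LinearEquiv.ofEq _ _ hexact)
  let ψ : (LinearMap.ker π →ₗ[R] B →ₗ[R] C) ≃ₗ[R] (LinearMap.ker (π.rTensor B) →ₗ[R] C) :=
    (TensorProduct.lift.equiv (RingHom.id R) (LinearMap.ker π) B C).trans
      (e.congrLeft C R)
  have hψ : ∀ g : F →ₗ[R] B →ₗ[R] C, ψ (g ∘ₗ i) =
      TensorProduct.lift g ∘ₗ (LinearMap.ker (π.rTensor B)).subtype := fun g => by
    ext z
    obtain ⟨x, rfl⟩ := e.surjective z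
    have h1 : ψ (g ∘ₗ i) (e x) = TensorProduct.lift (g ∘ₗ i) x := by
      change TensorProduct.lift (g ∘ₗ i) (e.symm (e x)) = _
      rw [e.symm_apply_apply]
    rw [h1]
    clear h1
    change _ = TensorProduct.lift g (i.rTensor B x)
    induction x with
    | zero => simp
    | tmul x b => simp
    | add x y hx hy => simp_all
  refine ⟨Submodule.Quotient.equiv _ _ ψ ?_⟩
  ext f
  constructor
  · rintro ⟨_, ⟨g, rfl⟩, rfl⟩
    exact ⟨TensorProduct.lift g, (hψ g).symm⟩
  · rintro ⟨g, rfl⟩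
    refine ⟨TensorProduct.curry g ∘ₗ i, ⟨TensorProduct.curry g, rfl⟩, ?_⟩
    refine (hψ _).trans ?_
    congr 1
    exact TensorProduct.ext' fun _ _ => rfl

theorem LiftsAlongExtensionsBy.isTorsionFree_int {B : Type} [AddCommGroup B]
    (hB : LiftsAlongExtensionsBy ℤ B ℤ) : Module.IsTorsionFree ℤ B := by
  refine Module.IsTorsionFree.of_smul_eq_zero fun a b hab => ?_
  by_contra! hne
  obtain ⟨ha, hb⟩ := hne
  obtain ⟨c, hc⟩ := CharacterModule.exists_character_apply_ne_zero_of_ne_zero hb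
  let r : ℚ →+ AddCircle (1 : ℚ) := QuotientAddGroup.mk' _
  obtain ⟨g, hg⟩ := hB ℚ (AddCircle (1 : ℚ)) (Int.castAddHom ℚ).toIntLinearMap r.toIntLinearMap
    Int.cast_injective (fun x => by
      refine (AddCircle.coe_eq_zero_iff (1 : ℚ)).trans ?_
      simp) (QuotientAddGroup.mk'_surjective _)
    (AddMonoidHom.toIntLinearMap (M₂ := AddCircle (1 : ℚ)) c)
  have hgb : g b = 0 := by
    have : a • g b = 0 := by rw [← map_zsmul, hab, map_zero]
    exact (smul_eq_zero.1 this).resolve_left ha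
  have hcb : r (g b) = c b := LinearMap.congr_fun hg b
  exact hc (by rw [← hcb, hgb, map_zero])

end ExtensionProblems

namespace CategoryTheory.ProjectiveResolution

universe u

variable {R : Type u} [CommRing R] {X : ModuleCat.{u} R} (P : ProjectiveResolution X)

theorem surjective_π_f_zero : Function.Surjective (P.π.f 0).hom :=
  (ModuleCat.epi_iff_surjective _).1 inferInstance

theorem nonempty_ext_one_equiv_restrictionCoker (Y : ModuleCat.{u} R) :
    Nonempty (((Ext R (ModuleCat.{u} R) 1).obj (Opposite.op X)).obj Y ≃ₗ[R]
      RestrictionCoker (LinearMap.ker (P.π.f 0).hom) Y) := by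
  have hexact₀ := P.exact₀.moduleCat_range_eq_ker
  have hexact₁ := (P.exact_succ 0).moduleCat_range_eq_ker
  let K := LinearMap.ker (P.π.f 0).hom
  let d : P.complex.X 1 →ₗ[R] K :=
    (P.complex.d 1 0).hom.codRestrict K fun x => hexact₀.le (LinearMap.mem_range_self _ x)
  have hd : Function.Surjective d := fun ⟨x, hx⟩ => by
    obtain ⟨y, hy⟩ := hexact₀.ge hx
    exact ⟨y, Subtype.ext hy⟩
  have hd₂ : ∀ x, d ((P.complex.d 2 1).hom x) = 0 := fun x => Subtype.ext
    (hexact₁.le (LinearMap.mem_range_self _ x))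
  let S := (P.complex.linearYonedaObj R Y).sc' 0 1 2
  let e₁ : ((Ext R (ModuleCat.{u} R) 1).obj (Opposite.op X)).obj Y ≅
      S.moduleCatLeftHomologyData.H :=
    P.isoExt 1 Y ≪≫
      (ShortComplex.homologyMapIso
        ((P.complex.linearYonedaObj R Y).isoSc' 0 1 2 (by simp) (by simp))) ≪≫
      S.moduleCatHomologyIso
  let ψ : (K →ₗ[R] Y) →ₗ[R] LinearMap.ker S.g.hom :=
    { toFun := fun h => ⟨ModuleCat.ofHom (h ∘ₗ d), by
        refine LinearMap.mem_ker.2 (ModuleCat.hom_ext (LinearMap.ext fun x => ?_))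
        exact (congrArg h (hd₂ x)).trans (map_zero h)⟩
      map_add' := fun _ _ => rfl
      map_smul' := fun _ _ => rfl }
  let φ : (K →ₗ[R] Y) →ₗ[R] (LinearMap.ker S.g.hom ⧸ LinearMap.range S.moduleCatToCycles) :=
    Submodule.mkQ _ ∘ₗ ψ
  have hφ : Function.Surjective φ := by
    refine (Submodule.mkQ_surjective _).comp fun ⟨f, hf⟩ => ?_
    have hle : LinearMap.ker d ≤ LinearMap.ker (ModuleCat.Hom.hom f) := fun x hx => by
      obtain ⟨y, rfl⟩ := hexact₁.ge (congrArg Subtype.val hx)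
      exact LinearMap.congr_fun (congrArg ModuleCat.Hom.hom hf) y
    obtain ⟨h, hh⟩ := LinearMap.exists_comp_eq_of_ker_le hd hle
    exact ⟨h, Subtype.ext (ModuleCat.hom_ext hh)⟩
  have hker : LinearMap.ker φ = LinearMap.range (LinearMap.lcomp R Y K.subtype) := by
    ext h
    rw [LinearMap.mem_ker]
    refine (Submodule.Quotient.mk_eq_zero _).trans ⟨?_, ?_⟩
    · rintro ⟨g, hg⟩
      refine ⟨ModuleCat.Hom.hom g, LinearMap.ext fun y => ?_⟩
      obtain ⟨x, rfl⟩ := hd y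
      exact LinearMap.congr_fun (congrArg ModuleCat.Hom.hom (congrArg Subtype.val hg)) x
    · rintro ⟨g, rfl⟩
      exact ⟨ModuleCat.ofHom g, rfl⟩
  exact ⟨e₁.toLinearEquiv.trans
    ((Submodule.quotEquivOfEq _ _ hker.symm).trans (φ.quotKerEquivOfSurjective hφ)).symm⟩

theorem module_projective_complex_X (n : ℕ) : Module.Projective R (P.complex.X n) :=
  (IsProjective.iff_projective _).2 (P.projective n)

end CategoryTheory.ProjectiveResolution

section TensorHom

universe u

variable {R : Type u} [CommRing R]

theorem liftsAlongExtensionsBy_of_subsingleton_ext {X Y : ModuleCat.{u} R}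
    (h : Subsingleton (((Ext R (ModuleCat.{u} R) 1).obj (Opposite.op X)).obj Y)) :
    LiftsAlongExtensionsBy R X Y := by
  let P := (inferInstance : HasProjectiveResolution X).out.some
  have := P.module_projective_complex_X 0
  obtain ⟨e⟩ := P.nonempty_ext_one_equiv_restrictionCoker Y
  let π : P.complex.X 0 →ₗ[R] X := (P.π.f 0).hom
  have : Subsingleton (RestrictionCoker (LinearMap.ker π) Y) := e.symm.toEquiv.subsingleton
  exact liftsAlongExtensionsBy_of_forall_extends (p := π) P.surjective_π_f_zero fun f =>
    (Submodule.Quotient.mk_eq_zero (LinearMap.range (LinearMap.lcomp R Y _))).1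
      (Subsingleton.elim (Submodule.Quotient.mk f) 0)

/-- `Ext¹(A, Hom(B, C)) ≅ Ext¹(A ⊗ B, C)` if `B` is flat and `Ext¹(B, C) = 0`. -/
theorem nonempty_ext_one_hom_equiv_ext_one_tensorProduct (A B C : Type u)
    [AddCommGroup A] [Module R A] [AddCommGroup B] [Module R B] [AddCommGroup C] [Module R C]
    [Module.Flat R B] (hB : LiftsAlongExtensionsBy R B C) :
    Nonempty (((Ext R (ModuleCat.{u} R) 1).obj (Opposite.op (ModuleCat.of R A))).obj
        (ModuleCat.of R (B →ₗ[R] C)) ≃ₗ[R]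
      ((Ext R (ModuleCat.{u} R) 1).obj (Opposite.op (ModuleCat.of R (TensorProduct R A B)))).obj
        (ModuleCat.of R C)) := by
  let P := (inferInstance : HasProjectiveResolution (ModuleCat.of R A)).out.some
  let T := (inferInstance : HasProjectiveResolution (ModuleCat.of R (TensorProduct R A B))).out.some
  have := P.module_projective_complex_X 0
  have := T.module_projective_complex_X 0
  let π : P.complex.X 0 →ₗ[R] A := (P.π.f 0).hom
  have hπ : Function.Surjective π := P.surjective_π_f_zero
  obtain ⟨e₁⟩ := P.nonempty_ext_one_equiv_restrictionCoker (ModuleCat.of R (B →ₗ[R] C))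
  obtain ⟨e₂⟩ := nonempty_restrictionCoker_dual_equiv (B := B) (C := C) hπ
  obtain ⟨e₃⟩ := nonempty_restrictionCoker_ker_equiv (LinearMap.rTensor_surjective B hπ)
    T.surjective_π_f_zero hB.tensorProduct liftsAlongExtensionsBy_of_projective
  obtain ⟨e₄⟩ := T.nonempty_ext_one_equiv_restrictionCoker (ModuleCat.of R C)
  exact ⟨e₁.trans (e₂.trans (e₃.trans e₄.symm))⟩

end TensorHom

/-- For Whitehead groups `A` and `B`, `Ext¹(A, B*) ≅ Ext¹(A ⊗ B, ℤ)` as abelian groups. -/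
theorem ext_dual_iso_ext_tensor (A B : Type) [AddCommGroup A] [AddCommGroup B]
    (hA : IsWhitehead A) (hB : IsWhitehead B) :
    Nonempty (Ext1 A (B →+ ℤ) ≃+ Ext1 (TensorProduct ℤ A B) ℤ) := by
  have hB' : LiftsAlongExtensionsBy ℤ B ℤ :=
    liftsAlongExtensionsBy_of_subsingleton_ext (X := ModuleCat.of ℤ B) (Y := ModuleCat.of ℤ ℤ) hB
  have : Module.IsTorsionFree ℤ B := hB'.isTorsionFree_int
  let dualIso : ModuleCat.of ℤ (B →+ ℤ) ≅ ModuleCat.of ℤ (B →ₗ[ℤ] ℤ) :=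
    (addMonoidHomLequivInt ℤ).toModuleIso
  obtain ⟨e⟩ := nonempty_ext_one_hom_equiv_ext_one_tensorProduct A B ℤ hB'
  have e' := (((Ext ℤ (ModuleCat.{0} ℤ) 1).obj (Opposite.op (ModuleCat.of ℤ A))).mapIso
    dualIso).toLinearEquiv.toAddEquiv.trans e.toAddEquiv
  -- the tensor product carries two propositionally equal `ℤ`-module structures
  rw [Subsingleton.elim (TensorProduct.instModule : Module ℤ (TensorProduct ℤ A B))
    (AddCommGroup.toIntModule _)] at e'
  exact ⟨e'⟩
end

section
/- Let A and B be Whitehead groups. Then the following are equivalent: (i) A ⊗ B is a Whitehead group; (ii) Ext^1_ℤ(A, B*) = 0; (iii) Ext^1_ℤ(B, A*) = 0, where A* = Hom(A, ℤ) and B* = Hom(B, ℤ). -/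
open CategoryTheory

namespace WhiteheadTensor

/-- The degree-one Ext group vanishes exactly when every morphism into the cokernel of a short
exact sequence with injective middle term lifts to the middle term. -/
lemma isZero_Ext_one_iff {R C : Type*} [Ring R] [Category* C] [Abelian C] [Linear R C]
    [EnoughProjectives C] {S : ShortComplex C} (hS : S.ShortExact) [Injective S.X₂] (X : C) :
    Limits.IsZero (((Ext R C 1).obj (Opposite.op X)).obj S.X₁) ↔
      ∀ φ : X ⟶ S.X₃, ∃ ψ : X ⟶ S.X₂, ψ ≫ S.g = φ := by
  have := hS.mono_f
  have := hS.epi_g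
  let P := projectiveResolution X
  have hP₁ := P.exact_succ 0
  obtain ⟨π, w, _, hP₀⟩ : ∃ (π : P.complex.X 0 ⟶ X) (w : P.complex.d 1 0 ≫ π = 0),
      Epi π ∧ (ShortComplex.mk _ _ w).Exact :=
    ⟨P.π.f 0, P.complex_d_comp_π_f_zero, inferInstanceAs (Epi (P.π.f 0)), P.exact₀⟩
  have : Epi (ShortComplex.mk _ _ w).g := ‹Epi π›
  rw [(P.isoExt 1 S.X₁).isZero_iff, ← HomologicalComplex.exactAt_iff_isZero_homology,
    HomologicalComplex.exactAt_iff' _ 0 1 2 (by simp) (by simp),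
    ShortComplex.moduleCat_exact_iff]
  change (∀ f : P.complex.X 1 ⟶ S.X₁, P.complex.d 2 1 ≫ f = 0 →
    ∃ g : P.complex.X 0 ⟶ S.X₁, P.complex.d 1 0 ≫ g = f) ↔ _
  constructor
  · intro h φ
    let ψ := Projective.factorThru (π ≫ φ) S.g
    have hψ : ψ ≫ S.g = π ≫ φ := Projective.factorThru_comp _ _
    have hd : (P.complex.d 1 0 ≫ ψ) ≫ S.g = 0 := by simp [hψ, reassoc_of% w]
    obtain ⟨g, hg⟩ := h (hS.exact.lift (P.complex.d 1 0 ≫ ψ) hd) (by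
      rw [← cancel_mono S.f]; simp)
    have hg' : P.complex.d 1 0 ≫ (ψ - g ≫ S.f) = 0 := by
      rw [Preadditive.comp_sub, reassoc_of% hg]; simp
    refine ⟨hP₀.desc (ψ - g ≫ S.f) hg', ?_⟩
    rw [← cancel_epi π]
    have := hP₀.g_desc _ hg'
    dsimp only at this
    rw [reassoc_of% this]
    simp [hψ]
  · intro h f hf
    have hf' : P.complex.d 2 1 ≫ f ≫ S.f = 0 := by rw [reassoc_of% hf]; simp
    let ψ : P.complex.X 0 ⟶ S.X₂ := hP₁.descToInjective (f ≫ S.f) hf'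
    have hψ : P.complex.d 1 0 ≫ ψ = f ≫ S.f := hP₁.comp_descToInjective _ hf'
    have hd : P.complex.d 1 0 ≫ ψ ≫ S.g = 0 := by rw [reassoc_of% hψ]; simp
    obtain ⟨l, hl⟩ := h (hP₀.desc (ψ ≫ S.g) hd)
    have hl' : (ψ - π ≫ l) ≫ S.g = 0 := by
      have := hP₀.g_desc _ hd
      dsimp only at this
      rw [Preadditive.sub_comp, Category.assoc, hl, this, sub_self]
    refine ⟨hS.exact.lift _ hl', ?_⟩
    rw [← cancel_mono S.f]
    simp [hψ, reassoc_of% w]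

/-- A rational vector space is an injective abelian group. -/
lemma injective_of_rat_module (V : Type) [AddCommGroup V] [Module ℚ V] :
    Injective (ModuleCat.of ℤ V) := by
  let : DivisibleBy V ℤ :=
    { div v n := (n : ℚ)⁻¹ • v
      div_zero v := by simp
      div_cancel {n} v hn := by
        rw [← Int.cast_smul_eq_zsmul ℚ, smul_inv_smul₀ (by exact_mod_cast hn)] }
  exact (AddCommGrpCat.injective_as_module_iff V).mpr inferInstance

/-- Given an exact sequence `0 → C → I → Q → 0` with `I` a rational vector space,
`Ext¹(A, C) = 0` if and only if every homomorphism `A → Q` lifts to `I`. -/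
lemma subsingleton_Ext1_iff (A : Type) {C I Q : Type} [AddCommGroup A] [AddCommGroup C]
    [AddCommGroup I] [AddCommGroup Q] [Module ℚ I] (i : C →+ I) (q : I →+ Q)
    (hi : Function.Injective i) (hq : Function.Surjective q) (hiq : Function.Exact i q) :
    Subsingleton (Ext1 A C) ↔ ∀ φ : A →+ Q, ∃ ψ : A →+ I, q.comp ψ = φ := by
  let S : ShortComplex (ModuleCat.{0} ℤ) := ModuleCat.shortComplexOfCompEqZero
    i.toIntLinearMap q.toIntLinearMap (by ext x; exact hiq.apply_apply_eq_zero x)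
  have hS : S.ShortExact := ModuleCat.shortComplex_shortExact S hiq hi hq
  have : Injective S.X₂ := injective_of_rat_module I
  rw [← ModuleCat.isZero_iff_subsingleton]
  refine (isZero_Ext_one_iff (R := ℤ) hS (ModuleCat.of ℤ A)).trans ⟨fun h φ ↦ ?_, fun h φ ↦ ?_⟩
  · obtain ⟨ψ, hψ⟩ := h (ModuleCat.ofHom φ.toIntLinearMap)
    exact ⟨ψ.hom.toAddMonoidHom, AddMonoidHom.ext fun a ↦ ConcreteCategory.congr_hom hψ a⟩
  · obtain ⟨ψ, hψ⟩ := h φ.hom.toAddMonoidHom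
    exact ⟨ModuleCat.ofHom ψ.toIntLinearMap,
      ModuleCat.hom_ext (LinearMap.ext fun a ↦ DFunLike.congr_fun hψ a)⟩

/-- The group `ℚ / ℤ`. -/
abbrev RatModInt : Type := ℚ ⧸ (Int.castAddHom ℚ).range

/-- The projection `ℚ → ℚ / ℤ`. -/
abbrev ratToRatModInt : ℚ →+ RatModInt := QuotientAddGroup.mk' _

lemma exact_intCast_ratToRatModInt :
    Function.Exact (Int.castAddHom ℚ) ratToRatModInt := fun x ↦ by
  rw [QuotientAddGroup.mk'_apply, QuotientAddGroup.eq_zero_iff]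
  rfl

/-- `A` is a Whitehead group if and only if every homomorphism `A → ℚ / ℤ` lifts to `ℚ`. -/
lemma isWhitehead_iff (A : Type) [AddCommGroup A] :
    IsWhitehead A ↔ ∀ φ : A →+ RatModInt, ∃ ψ : A →+ ℚ, ratToRatModInt.comp ψ = φ :=
  subsingleton_Ext1_iff A _ _ Int.cast_injective (QuotientAddGroup.mk'_surjective _)
    exact_intCast_ratToRatModInt

/-- For a Whitehead group `B`, `Ext¹(A, B*) = 0` if and only if every homomorphism
`A → Hom(B, ℚ / ℤ)` lifts to `Hom(B, ℚ)`. -/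
lemma subsingleton_Ext1_dual_iff (A : Type) {B : Type} [AddCommGroup A] [AddCommGroup B]
    (hB : IsWhitehead B) :
    Subsingleton (Ext1 A (B →+ ℤ)) ↔ ∀ φ : A →+ B →+ RatModInt, ∃ ψ : A →+ B →+ ℚ,
      (AddMonoidHom.compHom ratToRatModInt).comp ψ = φ := by
  refine subsingleton_Ext1_iff A (AddMonoidHom.compHom (Int.castAddHom ℚ)) _ (fun f g h ↦ ?_)
    ((isWhitehead_iff B).mp hB) (fun f ↦ ⟨fun h ↦ ?_, ?_⟩)
  · ext b
    exact Int.cast_injective (DFunLike.congr_fun h b)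
  · choose g hg using fun b ↦ (exact_intCast_ratToRatModInt (f b)).mp (DFunLike.congr_fun h b)
    refine ⟨AddMonoidHom.mk' g fun a b ↦ Int.cast_injective (α := ℚ) ?_, AddMonoidHom.ext hg⟩
    simpa using (hg (a + b)).trans ((map_add f a b).trans (by rw [← hg a, ← hg b]; rfl))
  · rintro ⟨g, rfl⟩
    ext b
    exact exact_intCast_ratToRatModInt.apply_apply_eq_zero (g b)

/-- The additive map on a tensor product induced by a biadditive map. -/
noncomputable def tensorLift {A B G : Type} [AddCommGroup A] [AddCommGroup B] [AddCommGroup G]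
    (f : A →+ B →+ G) : TensorProduct ℤ A B →+ G :=
  TensorProduct.liftAddHom f fun r a b ↦ by simp

/-- The biadditive map corresponding to an additive map on a tensor product. -/
noncomputable def tensorCurry {A B G : Type} [AddCommGroup A] [AddCommGroup B] [AddCommGroup G]
    (f : TensorProduct ℤ A B →+ G) : A →+ B →+ G :=
  AddMonoidHom.mk' (fun a ↦ f.comp (TensorProduct.mk ℤ A B a).toAddMonoidHom) fun a a' ↦ by
    ext b
    simp

lemma isWhitehead_tensor_iff_lift (A B : Type) [AddCommGroup A] [AddCommGroup B] :
    IsWhitehead (TensorProduct ℤ A B) ↔ ∀ φ : A →+ B →+ RatModInt, ∃ ψ : A →+ B →+ ℚ,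
      (AddMonoidHom.compHom ratToRatModInt).comp ψ = φ := by
  rw [isWhitehead_iff]
  refine ⟨fun h φ ↦ ?_, fun h φ ↦ ?_⟩
  · obtain ⟨ψ, hψ⟩ := h (tensorLift φ)
    exact ⟨tensorCurry ψ, AddMonoidHom.ext fun a ↦ AddMonoidHom.ext fun b ↦
      DFunLike.congr_fun hψ (TensorProduct.tmul ℤ a b)⟩
  · obtain ⟨ψ, hψ⟩ := h (tensorCurry φ)
    refine ⟨tensorLift ψ, AddMonoidHom.ext fun x ↦ ?_⟩
    induction x with
    | zero => simp only [map_zero]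
    | add x y hx hy => rw [map_add, map_add, hx, hy]
    | tmul a b => exact DFunLike.congr_fun (DFunLike.congr_fun hψ a) b

/-- For a Whitehead group `B`, `A ⊗ B` is Whitehead if and only if `Ext¹(A, B*) = 0`. -/
lemma isWhitehead_tensor_iff (A : Type) {B : Type} [AddCommGroup A] [AddCommGroup B]
    (hB : IsWhitehead B) :
    IsWhitehead (TensorProduct ℤ A B) ↔ Subsingleton (Ext1 A (B →+ ℤ)) :=
  (isWhitehead_tensor_iff_lift A B).trans (subsingleton_Ext1_dual_iff A hB).symm

lemma IsWhitehead.tensor_comm {A B : Type} [AddCommGroup A] [AddCommGroup B]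
    (h : IsWhitehead (TensorProduct ℤ A B)) : IsWhitehead (TensorProduct ℤ B A) := by
  rw [isWhitehead_tensor_iff_lift] at h ⊢
  intro φ
  obtain ⟨ψ, hψ⟩ := h φ.flip
  exact ⟨ψ.flip, AddMonoidHom.ext fun b ↦ AddMonoidHom.ext fun a ↦
    DFunLike.congr_fun (DFunLike.congr_fun hψ a) b⟩

end WhiteheadTensor

/-- For Whitehead groups `A` and `B`, the following are equivalent:
(i) `A ⊗ B` is Whitehead; (ii) `Ext¹(A, B*) = 0`; (iii) `Ext¹(B, A*) = 0`. -/
theorem tensor_whitehead_tfae (A B : Type) [AddCommGroup A] [AddCommGroup B]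
    (hA : IsWhitehead A) (hB : IsWhitehead B) :
    List.TFAE [IsWhitehead (TensorProduct ℤ A B),
               Subsingleton (Ext1 A (B →+ ℤ)),
               Subsingleton (Ext1 B (A →+ ℤ))] := by
  tfae_have 1 ↔ 2 := WhiteheadTensor.isWhitehead_tensor_iff A hB
  tfae_have 1 ↔ 3 :=
    ⟨fun h ↦ (WhiteheadTensor.isWhitehead_tensor_iff B hA).mp
        (WhiteheadTensor.IsWhitehead.tensor_comm h),
      fun h ↦ WhiteheadTensor.IsWhitehead.tensor_comm
        ((WhiteheadTensor.isWhitehead_tensor_iff B hA).mpr h)⟩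
  tfae_finish
end

section
/- Let A and B be abelian groups. If the tensor product A ⊗ B (over ℤ) is a nonzero Whitehead group, then A is a Whitehead group. -/
open CategoryTheory

namespace AddMonoidHom

/-- A homomorphism that vanishes on the kernel of a surjection factors through it. -/
theorem exists_factor_of_surjective {X Y Z : Type*} [AddCommGroup X] [AddCommGroup Y]
    [AddCommGroup Z] (f : X →+ Y) (hf : Function.Surjective f) (g : X →+ Z)
    (h : ∀ x, f x = 0 → g x = 0) : ∃ k : Y →+ Z, ∀ x, k (f x) = g x := by
  obtain ⟨s, hs⟩ := hf.hasRightInverse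
  exact ⟨f.liftOfRightInverse s hs ⟨g, fun x hx => h x hx⟩,
    fun x => f.liftOfRightInverse_comp_apply s hs _ x⟩

/-- An additive map between `ℤ`-modules is `ℤ`-linear, whatever the module structures are. -/
def toIntLinearMapOfModule {M N : Type*} [AddCommGroup M] [AddCommGroup N] [Module ℤ M]
    [Module ℤ N] (f : M →+ N) : M →ₗ[ℤ] N where
  toFun := f
  map_add' := f.map_add
  map_smul' c x := by simpa using map_intCast_smul f ℤ ℤ c x

end AddMonoidHom

/-- Every integer-valued homomorphism on the kernel of a surjection onto `A` extends. -/
def ExtendsFromKernels (A : Type) [AddCommGroup A] : Prop :=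
  ∀ (M : Type) [AddCommGroup M] (p : M →+ A), Function.Surjective p →
    ∀ g : p.ker →+ ℤ, ∃ h : M →+ ℤ, ∀ k : p.ker, h k = g k

/-- `Ext¹` read off from a projective resolution: it vanishes iff 1-cocycles are coboundaries. -/
theorem isWhitehead_iff_of_projectiveResolution {A : Type} [AddCommGroup A]
    (P : ProjectiveResolution (ModuleCat.of ℤ A)) :
    IsWhitehead A ↔ ∀ g : P.complex.X 1 ⟶ ModuleCat.of ℤ ℤ, P.complex.d 2 1 ≫ g = 0 →
      ∃ h : P.complex.X 0 ⟶ ModuleCat.of ℤ ℤ, P.complex.d 1 0 ≫ h = g := by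
  have e := P.isoExt (R := ℤ) 1 (ModuleCat.of ℤ ℤ)
  rw [IsWhitehead, ← ModuleCat.isZero_iff_subsingleton, e.isZero_iff,
    ← HomologicalComplex.exactAt_iff_isZero_homology,
    HomologicalComplex.exactAt_iff' _ 0 1 2 (by simp) (by simp), ShortComplex.moduleCat_exact_iff]
  rfl

theorem IsWhitehead.extendsFromKernels {A : Type} [AddCommGroup A] (hA : IsWhitehead A) :
    ExtendsFromKernels A := by
  intro M _ p hp g
  let P := projectiveResolution (ModuleCat.of ℤ A)
  let ε : P.complex.X 0 ⟶ ModuleCat.of ℤ A := P.π.f 0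
  have hε : P.complex.d 1 0 ≫ ε = 0 := P.complex_d_comp_π_f_zero
  have hex := (ShortComplex.moduleCat_exact_iff _).1 P.exact₀
  have hsurj : Function.Surjective ε := (ModuleCat.epi_iff_surjective ε).1
    (inferInstanceAs (Epi (P.π.f 0)))
  let q : ModuleCat.of ℤ M ⟶ ModuleCat.of ℤ A := ModuleCat.ofHom p.toIntLinearMapOfModule
  have : Epi q := (ModuleCat.epi_iff_surjective q).2 hp
  let u : P.complex.X 0 ⟶ ModuleCat.of ℤ M := Projective.factorThru ε q
  have hu : ∀ x, p (u x) = ε x := fun x => ConcreteCategory.congr_hom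
    (Projective.factorThru_comp ε q) x
  have hd : ∀ x, ε (P.complex.d 1 0 x) = 0 := fun x => ConcreteCategory.congr_hom hε x
  let v : P.complex.X 1 →+ p.ker :=
    (u.hom.toAddMonoidHom.comp (P.complex.d 1 0).hom.toAddMonoidHom).codRestrict _
      fun x => (hu _).trans (hd x)
  obtain ⟨h, hh⟩ := (isWhitehead_iff_of_projectiveResolution P).1 hA
    (ModuleCat.ofHom (g.comp v).toIntLinearMapOfModule) (by
      ext x
      have h0 : P.complex.d 1 0 (P.complex.d 2 1 x) = 0 :=
        ConcreteCategory.congr_hom (P.complex.d_comp_d 2 1 0) x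
      have : v (P.complex.d 2 1 x) = 0 := Subtype.ext (by
        change u (P.complex.d 1 0 (P.complex.d 2 1 x)) = 0
        rw [h0, map_zero])
      change g (v (P.complex.d 2 1 x)) = 0
      rw [this, map_zero])
  have hh' : ∀ x, h (P.complex.d 1 0 x) = g (v x) := fun x => ConcreteCategory.congr_hom hh x
  obtain ⟨k, hk⟩ := AddMonoidHom.exists_factor_of_surjective
    (p.ker.subtype.coprod u.hom.toAddMonoidHom) (fun m => by
      obtain ⟨x, hx⟩ := hsurj (p m)
      exact ⟨(⟨m - u x, by simp [AddMonoidHom.mem_ker, hu, hx]⟩, x), sub_add_cancel m (u x)⟩)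
    (g.coprod h.hom.toAddMonoidHom) (by
      rintro ⟨i, x⟩ hix
      replace hix : (i : M) + u x = 0 := hix
      have hx : ε x = 0 := by
        have := congrArg p hix
        rwa [map_add, map_zero, (AddMonoidHom.mem_ker).1 i.2, zero_add, hu] at this
      obtain ⟨y, rfl⟩ := hex x hx
      have hv : i + v y = 0 := Subtype.ext hix
      change g i + h (P.complex.d 1 0 y) = 0
      rw [hh', ← map_add, hv, map_zero])
  refine ⟨k, fun i => ?_⟩
  simpa using hk (i, 0)

theorem ExtendsFromKernels.isWhitehead {A : Type} [AddCommGroup A] (hA : ExtendsFromKernels A) :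
    IsWhitehead A := by
  let P := projectiveResolution (ModuleCat.of ℤ A)
  rw [isWhitehead_iff_of_projectiveResolution P]
  intro g hg
  let ε : P.complex.X 0 ⟶ ModuleCat.of ℤ A := P.π.f 0
  have hex := (ShortComplex.moduleCat_exact_iff _).1 P.exact₀
  have hex' := (ShortComplex.moduleCat_exact_iff _).1 (P.exact_succ 0)
  have hsurj : Function.Surjective ε := (ModuleCat.epi_iff_surjective ε).1
    (inferInstanceAs (Epi (P.π.f 0)))
  let p : P.complex.X 0 →+ A := ε.hom.toAddMonoidHom
  have hd : ∀ x, ε (P.complex.d 1 0 x) = 0 := fun x => ConcreteCategory.congr_hom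
    (show P.complex.d 1 0 ≫ ε = 0 from P.complex_d_comp_π_f_zero) x
  let v : P.complex.X 1 →+ p.ker := (P.complex.d 1 0).hom.toAddMonoidHom.codRestrict _ hd
  obtain ⟨k, hk⟩ := AddMonoidHom.exists_factor_of_surjective v
    (fun i => (hex i.1 i.2).imp fun y hy => Subtype.ext hy) g.hom.toAddMonoidHom (fun x hx => by
      obtain ⟨y, rfl⟩ := hex' x (congrArg Subtype.val hx)
      exact ConcreteCategory.congr_hom hg y)
  obtain ⟨h, hh⟩ := hA _ p hsurj k
  refine ⟨ModuleCat.ofHom h.toIntLinearMapOfModule, ?_⟩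
  ext x
  exact (hh (v x)).trans (hk x)

/-- A homomorphism from a Whitehead group lifts along any surjection with kernel `ℤ`. -/
theorem ExtendsFromKernels.exists_lift {W E Q : Type} [AddCommGroup W] [AddCommGroup E]
    [AddCommGroup Q] (hW : ExtendsFromKernels W) (p : E →+ Q) (hp : Function.Surjective p)
    (ι : ℤ →+ E) (hι : Function.Injective ι) (hιp : ∀ x, p x = 0 ↔ ∃ n, ι n = x)
    (f : W →+ Q) : ∃ l : W →+ E, ∀ w, p (l w) = f w := by
  let D : AddSubgroup (E × W) :=
    (p.comp (AddMonoidHom.fst E W)).eqLocus (f.comp (AddMonoidHom.snd E W))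
  have hD : ∀ d : D, p d.1.1 = f d.1.2 := fun d => d.2
  let r : D →+ W := (AddMonoidHom.snd E W).comp D.subtype
  have hr : Function.Surjective r := fun w =>
    (hp (f w)).elim fun e he => ⟨⟨(e, w), he⟩, rfl⟩
  have hker : ∀ k : r.ker, ∃ n, ι n = k.1.1.1 := fun k => by
    have hk : k.1.1.2 = 0 := k.2
    rw [← hιp, hD, hk, map_zero]
  choose c hc using hker
  obtain ⟨h, hh⟩ := hW D r hr
    (AddMonoidHom.mk' c fun a b => hι (by rw [map_add, hc, hc, hc]; rfl))
  obtain ⟨l, hl⟩ := AddMonoidHom.exists_factor_of_surjective r hr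
    ((AddMonoidHom.fst E W).comp D.subtype - ι.comp h) (fun d hd => by
      have h1 : h d = c ⟨d, hd⟩ := hh ⟨d, hd⟩
      simp [h1, hc])
  refine ⟨l, fun w => ?_⟩
  obtain ⟨d, rfl⟩ := hr w
  rw [hl]
  have : p (ι (h d)) = 0 := (hιp _).2 ⟨_, rfl⟩
  simp [this, hD, r]

/-- The subgroup of fractions whose denominator can be chosen in `S`. -/
def fractionsWithDenominators (S : Submonoid ℤ) : AddSubgroup ℚ where
  carrier := {q | ∃ m ∈ S, ∃ z : ℤ, m * q = z}
  zero_mem' := ⟨1, S.one_mem, 0, by simp⟩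
  add_mem' := by
    rintro a b ⟨m, hm, z, h⟩ ⟨n, hn, y, k⟩
    refine ⟨m * n, S.mul_mem hm hn, n * z + m * y, ?_⟩
    push_cast
    rw [← h, ← k]
    ring
  neg_mem' := by
    rintro a ⟨m, hm, z, h⟩
    exact ⟨m, hm, -z, by push_cast; rw [← h]; ring⟩

theorem mem_fractionsWithDenominators {S : Submonoid ℤ} {q : ℚ} :
    q ∈ fractionsWithDenominators S ↔ ∃ m ∈ S, ∃ z : ℤ, m * q = z := Iff.rfl

/-- There is no nonzero homomorphism from an `n`-divisible group to the fractions whose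
denominators are prime to `n`. -/
theorem eq_zero_of_divisible {W : Type*} [AddCommGroup W] {S : Submonoid ℤ} {n : ℕ} (hn : 2 ≤ n)
    (hS : ∀ m ∈ S, IsCoprime (n : ℤ) m) (hW : ∀ w : W, ∃ v, n • v = w)
    (f : W →+ fractionsWithDenominators S) (w : W) : f w = 0 := by
  have hpow : ∀ k : ℕ, ∀ w : W, ∃ v, n ^ k • v = w := fun k => by
    induction k with
    | zero => exact fun w => ⟨w, by simp⟩
    | succ k ih =>
      intro w
      obtain ⟨v, rfl⟩ := ih w
      obtain ⟨u, rfl⟩ := hW v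
      exact ⟨u, by rw [pow_succ, mul_smul]⟩
  have hdvd : ∀ k : ℕ, (n : ℤ) ^ k ∣ (f w : ℚ).num := fun k => by
    obtain ⟨v, rfl⟩ := hpow k w
    obtain ⟨m, hm, z, hz⟩ := mem_fractionsWithDenominators.1 (f v).2
    set q : ℚ := (f (n ^ k • v) : ℚ) with hq
    have hqv : q = (n : ℚ) ^ k * (f v : ℚ) := by simp [hq]
    have key : m * q.num = (n : ℤ) ^ k * (z * q.den) := by
      have hnum : (q.num : ℚ) = q * q.den := (Rat.mul_den_eq_num q).symm
      have : ((m * q.num : ℤ) : ℚ) = ((n : ℤ) ^ k * (z * q.den) : ℤ) := by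
        push_cast
        rw [hnum, ← hz]
        nth_rewrite 1 [hqv]
        ring
      exact_mod_cast this
    exact ((hS m hm).pow_left).dvd_of_dvd_mul_left ⟨_, key⟩
  have hnum : (f w : ℚ).num = 0 := by
    by_contra hne
    have hle := Int.natAbs_dvd_natAbs.2 (hdvd (f w : ℚ).num.natAbs)
    rw [Int.natAbs_pow, Int.natAbs_natCast] at hle
    exact absurd (Nat.le_of_dvd (Int.natAbs_pos.2 hne) hle)
      (not_le.2 (Nat.lt_pow_self (by omega)))
  exact Subtype.ext (Rat.num_eq_zero.1 hnum)

/-- A homomorphism from a Whitehead group to `ℚ / ℤ` lifts to `ℚ`. -/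
theorem ExtendsFromKernels.exists_lift_character {W : Type} [AddCommGroup W]
    (hW : ExtendsFromKernels W) (c : W →+ AddCircle (1 : ℚ)) :
    ∃ f : W →+ ℚ, ∀ w, (f w : AddCircle (1 : ℚ)) = c w :=
  hW.exists_lift (QuotientAddGroup.mk' (AddSubgroup.zmultiples (1 : ℚ)))
    (QuotientAddGroup.mk'_surjective _) (Int.castAddHom ℚ) Int.cast_injective
    (fun x => by
      rw [QuotientAddGroup.mk'_apply, QuotientAddGroup.eq_zero_iff, AddSubgroup.mem_zmultiples_iff]
      simp) c

/-- A Whitehead group that is divisible by `2` and by `3` is trivial. -/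
theorem ExtendsFromKernels.subsingleton_of_divisible {W : Type} [AddCommGroup W]
    (hW : ExtendsFromKernels W) (h2 : ∀ w : W, ∃ v, 2 • v = w) (h3 : ∀ w : W, ∃ v, 3 • v = w) :
    Subsingleton W := by
  have hQ : ∀ (f : W →+ ℚ) (w : W), f w = 0 := fun f w => by
    let S : Submonoid ℤ :=
      { carrier := {m | IsCoprime 2 m}
        one_mem' := isCoprime_one_right
        mul_mem' := fun ha hb => IsCoprime.mul_right ha hb }
    let T : Submonoid ℤ := Submonoid.powers 2
    have hS : ∀ m ∈ S, IsCoprime ((2 : ℕ) : ℤ) m := fun m hm => hm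
    have hT : ∀ m ∈ T, IsCoprime ((3 : ℕ) : ℤ) m := by
      rintro _ ⟨k, rfl⟩
      exact IsCoprime.pow_right ⟨1, -1, by norm_num⟩
    let p : fractionsWithDenominators S × fractionsWithDenominators T →+ ℚ :=
      (fractionsWithDenominators S).subtype.coprod (-(fractionsWithDenominators T).subtype)
    have hp : Function.Surjective p := fun q => by
      obtain ⟨k, m, hm, hden⟩ := Nat.exists_eq_two_pow_mul_odd q.den_nz
      have hcop : IsCoprime ((2 : ℤ)) m := Int.isCoprime_iff_gcd_eq_one.2 (by
        simpa [Int.gcd] using hm.coprime_two_left)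
      obtain ⟨a, b, hab⟩ := hcop.pow_left (m := k)
      have hab' : (a : ℚ) * 2 ^ k + b * m = 1 := by exact_mod_cast hab
      have hm0 : (m : ℚ) ≠ 0 := by
        have := hm.pos
        positivity
      have hqd : q * (2 ^ k * m) = q.num := by
        have := Rat.mul_den_eq_num q
        rw [hden] at this
        exact_mod_cast this
      refine ⟨(⟨q * (a * 2 ^ k), m, hcop, a * q.num, ?_⟩,
        ⟨-(q * (b * m)), 2 ^ k, ⟨k, rfl⟩, -(b * q.num), ?_⟩), ?_⟩
      · push_cast
        rw [← hqd]
        ring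
      · push_cast
        rw [← hqd]
        ring
      · change q * (a * 2 ^ k) + - -(q * (b * m)) = q
        rw [neg_neg, ← mul_add, hab', mul_one]
    have isInt : ∀ (R : Submonoid ℤ) (n : ℤ), (n : ℚ) ∈ fractionsWithDenominators R :=
      fun R n => ⟨1, R.one_mem, n, by simp⟩
    let ι : ℤ →+ fractionsWithDenominators S × fractionsWithDenominators T :=
      ((Int.castAddHom ℚ).codRestrict _ (isInt S)).prod ((Int.castAddHom ℚ).codRestrict _ (isInt T))
    have hι : Function.Injective ι := fun m n h =>
      Int.cast_injective (congrArg (fun x => (x.1 : ℚ)) h)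
    obtain ⟨l, hl⟩ := hW.exists_lift p hp ι hι (fun x => by
      constructor
      · intro hx
        obtain ⟨⟨s, m, hm, z, hz⟩, ⟨t, _, ⟨k, rfl⟩, y, hy⟩⟩ := x
        have hst : s = t := by
          replace hx : s + -t = 0 := hx
          linarith
        subst hst
        obtain ⟨a, b, hab⟩ := IsCoprime.pow_left (m := k) (show IsCoprime 2 m from hm)
        have hs : ((a * y + b * z : ℤ) : ℚ) = s := by
          have hab' : (a : ℚ) * 2 ^ k + b * m = 1 := by exact_mod_cast hab
          push_cast at hy ⊢
          rw [← hy, ← hz]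
          linear_combination s * hab'
        exact ⟨a * y + b * z, Prod.ext (Subtype.ext hs) (Subtype.ext hs)⟩
      · rintro ⟨n, rfl⟩
        exact add_neg_cancel (n : ℚ)) f
    have e1 := eq_zero_of_divisible le_rfl hS h2 ((AddMonoidHom.fst _ _).comp l) w
    have e2 := eq_zero_of_divisible (by norm_num) hT h3 ((AddMonoidHom.snd _ _).comp l) w
    rw [← hl, show l w = 0 from Prod.ext e1 e2, map_zero]
  refine subsingleton_of_forall_eq 0 fun w => ?_
  by_contra hw
  obtain ⟨c, hc⟩ : ∃ c : W →+ AddCircle (1 : ℚ), c w ≠ 0 :=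
    CharacterModule.exists_character_apply_ne_zero_of_ne_zero hw
  obtain ⟨f, hf⟩ := hW.exists_lift_character c
  exact hc ((hf w).symm.trans (by rw [hQ f w]; rfl))

/-- A Whitehead group that is not divisible by `n` has a nonzero homomorphism to `ℤ`. -/
theorem ExtendsFromKernels.exists_ne_zero_of_not_divisible {W : Type} [AddCommGroup W]
    (hW : ExtendsFromKernels W) {n : ℕ} (hn : n ≠ 0) {w : W} (hw : ∀ v, n • v ≠ w) :
    ∃ φ : W →+ ℤ, φ ≠ 0 := by
  let N : AddSubgroup W := (nsmulAddMonoidHom (α := W) n).range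
  have hwN : (w : W ⧸ N) ≠ 0 := fun h =>
    ((QuotientAddGroup.eq_zero_iff w).1 h).elim fun v hv => hw v hv
  obtain ⟨c, hc⟩ : ∃ c : W ⧸ N →+ AddCircle (1 : ℚ), c w ≠ 0 :=
    CharacterModule.exists_character_apply_ne_zero_of_ne_zero hwN
  obtain ⟨f, hf⟩ := hW.exists_lift_character (c.comp (QuotientAddGroup.mk' N))
  have isInt : ∀ v, ∃ z : ℤ, (z : ℚ) = n * f v := fun v => by
    have h0 : ((f (n • v) : ℚ) : AddCircle (1 : ℚ)) = 0 := by
      rw [hf]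
      have : QuotientAddGroup.mk' N (n • v) = 0 := (QuotientAddGroup.eq_zero_iff _).2 ⟨v, rfl⟩
      rw [AddMonoidHom.comp_apply, this, map_zero]
    obtain ⟨z, hz⟩ := AddSubgroup.mem_zmultiples_iff.1 ((QuotientAddGroup.eq_zero_iff _).1 h0)
    exact ⟨z, by simpa using hz⟩
  choose φ hφ using isInt
  refine ⟨AddMonoidHom.mk' φ fun a b => ?_, fun h => ?_⟩
  · have : ((φ (a + b) : ℤ) : ℚ) = ((φ a + φ b : ℤ) : ℚ) := by
      push_cast
      rw [hφ, hφ, hφ, map_add, mul_add]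
    exact_mod_cast this
  · have h0 : φ w = 0 := DFunLike.congr_fun h w
    have hfw : f w = 0 := by
      have := hφ w
      rw [h0, Int.cast_zero, eq_comm, mul_eq_zero] at this
      exact this.resolve_left (by exact_mod_cast hn)
    exact hc ((hf w).symm.trans (by rw [hfw]; rfl))

/-- A nonzero Whitehead group has a nonzero homomorphism to `ℤ`. -/
theorem ExtendsFromKernels.exists_ne_zero {W : Type} [AddCommGroup W] [Nontrivial W]
    (hW : ExtendsFromKernels W) : ∃ φ : W →+ ℤ, φ ≠ 0 := by
  by_cases h2 : ∀ w : W, ∃ v, 2 • v = w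
  · by_cases h3 : ∀ w : W, ∃ v, 3 • v = w
    · exact absurd (hW.subsingleton_of_divisible h2 h3) (not_subsingleton W)
    · push Not at h3
      obtain ⟨w, hw⟩ := h3
      exact hW.exists_ne_zero_of_not_divisible three_ne_zero hw
  · push Not at h2
    obtain ⟨w, hw⟩ := h2
    exact hW.exists_ne_zero_of_not_divisible two_ne_zero hw

/-- A group with a nonzero homomorphism to `ℤ` has a surjective one. -/
theorem exists_apply_eq_one_of_ne_zero {B : Type*} [AddCommGroup B] {φ : B →+ ℤ} (hφ : φ ≠ 0) :
    ∃ (f : B →+ ℤ) (b : B), f b = 1 := by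
  obtain ⟨n, hn⟩ := Int.subgroup_cyclic φ.range
  have hmem : ∀ b, ∃ z : ℤ, z * n = φ b := fun b => by
    have : φ b ∈ AddSubgroup.closure {n} := hn ▸ ⟨b, rfl⟩
    simpa using AddSubgroup.mem_closure_singleton.1 this
  have hn0 : n ≠ 0 := by
    rintro rfl
    exact hφ (AddMonoidHom.ext fun b => by
      obtain ⟨z, hz⟩ := hmem b
      simpa using hz.symm)
  choose f hf using hmem
  obtain ⟨b, hb⟩ : n ∈ φ.range := hn ▸ AddSubgroup.subset_closure rfl
  refine ⟨AddMonoidHom.mk' f fun x y => mul_right_cancel₀ hn0 ?_, b, mul_right_cancel₀ hn0 ?_⟩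
  · rw [add_mul, hf, hf, hf, map_add]
  · rw [AddMonoidHom.mk'_apply, hf, hb, one_mul]

open TensorProduct in
/-- If `A ⊗ B` is Whitehead and `B` maps onto `ℤ`, then `A` is Whitehead. -/
theorem ExtendsFromKernels.of_tensorProduct {A B : Type} [AddCommGroup A] [AddCommGroup B]
    (h : ExtendsFromKernels (A ⊗[ℤ] B)) {f : B →+ ℤ} {b : B} (hfb : f b = 1) :
    ExtendsFromKernels A := by
  intro M _ p hp g
  let P : M ⊗[ℤ] B →+ A ⊗[ℤ] B := (p.toIntLinearMap.rTensor B).toAddMonoidHom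
  have hP : ∀ m b, P (m ⊗ₜ b) = p m ⊗ₜ b := fun m b => LinearMap.rTensor_tmul B _ b m
  let θ (X : Type) [AddCommGroup X] : X ⊗[ℤ] B →+ X :=
    (TensorProduct.rid ℤ X).toAddMonoidHom.comp (f.toIntLinearMap.lTensor X).toAddMonoidHom
  have hθ : ∀ (X : Type) [AddCommGroup X] (x : X) (b : B), θ X (x ⊗ₜ b) = f b • x :=
    fun X _ x b => TensorProduct.rid_tmul (R := ℤ) x (f b)
  have hθP : ∀ x, p (θ M x) = θ A (P x) := fun x => by
    induction x with
    | zero => simp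
    | add x y hx hy => rw [map_add, map_add, map_add, map_add, hx, hy]
    | tmul m b => rw [hP, hθ, hθ, map_zsmul]
  let τ : P.ker →+ p.ker :=
    ((θ M).comp P.ker.subtype).codRestrict _ fun x => by
      have hx : P x.1 = 0 := x.2
      exact (hθP x.1).trans (by rw [hx, map_zero])
  obtain ⟨k, hk⟩ := h _ P (LinearMap.rTensor_surjective B hp) (g.comp τ)
  refine ⟨k.comp ((TensorProduct.mk ℤ M B).flip b).toAddMonoidHom, fun m => ?_⟩
  have hm : P (m.1 ⊗ₜ b) = 0 := by
    have : p m.1 = 0 := m.2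
    rw [hP, this, zero_tmul]
  refine (hk ⟨m.1 ⊗ₜ b, hm⟩).trans (congrArg g (Subtype.ext ?_))
  change θ M (m.1 ⊗ₜ b) = m.1
  rw [hθ, hfb, one_smul]

/-- If `A ⊗ B` is a nonzero Whitehead group, then `A` is a Whitehead group. -/
theorem whitehead_of_tensor_whitehead (A B : Type) [AddCommGroup A] [AddCommGroup B]
    (h1 : IsWhitehead (TensorProduct ℤ A B)) (h2 : Nontrivial (TensorProduct ℤ A B)) :
    IsWhitehead A := by
  have h := h1.extendsFromKernels
  obtain ⟨φ, hφ⟩ := h.exists_ne_zero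
  have hne : ∃ a : A, φ.comp (TensorProduct.mk ℤ A B a).toAddMonoidHom ≠ 0 := by
    by_contra! h0
    refine hφ (AddMonoidHom.ext fun x => ?_)
    induction x with
    | zero => simp
    | add x y hx hy => rw [map_add, map_add, hx, hy]
    | tmul a b => exact DFunLike.congr_fun (h0 a) b
  obtain ⟨a, ha⟩ := hne
  obtain ⟨f, b, hfb⟩ := exists_apply_eq_one_of_ne_zero ha
  exact (h.of_tensorProduct hfb).isWhitehead
end
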